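/- arXiv:1505.07553 — 2 statements merged into one kernel-verified Lean document; each statement's English description precedes it below -/
import Mathlib

section
/- Let f and s be nonzero polynomials with integer coefficients of degrees d_f = deg f and d_s = deg s. Then the resultant of f and s satisfies |Res(f, s)| ≤ (d_f + d_s)! · ‖f‖_∞^{d_s} · ‖s‖_∞^{d_f}, where ‖·‖_∞ denotes the maximum absolute value of the coefficients. -/
open Polynomial

/-- The Sylvester matrix of two integer polynomials `f` and `g`: the square matrix of
size `(deg f) + (deg g)` whose first `deg g` rows contain the shifted coefficients of
`f` and whose remaining `deg f` rows contain the shifted coefficients of `g`. -/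
def sylvester (f g : Polynomial ℤ) :
    Matrix (Fin (f.natDegree + g.natDegree)) (Fin (f.natDegree + g.natDegree)) ℤ :=
  Matrix.of fun i j =>
    if (i : ℕ) < g.natDegree then
      if (i : ℕ) ≤ (j : ℕ) then f.coeff ((j : ℕ) - (i : ℕ)) else 0
    else
      if (i : ℕ) - g.natDegree ≤ (j : ℕ) then
        g.coeff ((j : ℕ) - ((i : ℕ) - g.natDegree))
      else 0

/-- The resultant of two integer polynomials: the determinant of their Sylvester
matrix. -/
def resultant (f g : Polynomial ℤ) : ℤ := (_root_.sylvester f g).det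

/-- The infinity norm `‖f‖_∞` of an integer polynomial: the maximum of the absolute
values of its coefficients. -/
def normInf (f : Polynomial ℤ) : ℕ :=
  (Finset.range (f.natDegree + 1)).sup fun i => (f.coeff i).natAbs

theorem abs_coeff_le_normInf (f : Polynomial ℤ) (k : ℕ) : |f.coeff k| ≤ (normInf f : ℤ) := by
  rw [Int.abs_eq_natAbs, Nat.cast_le]
  by_cases hk : k < f.natDegree + 1
  · exact Finset.le_sup (f := fun i => (f.coeff i).natAbs) (Finset.mem_range.mpr hk)
  · simp [Polynomial.coeff_eq_zero_of_natDegree_lt (show f.natDegree < k by omega)]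

theorem abs_det_le_factorial_mul_prod {n R : Type*} [Fintype n] [DecidableEq n] [CommRing R]
    [LinearOrder R] [IsStrictOrderedRing R] (A : Matrix n n R) (c : n → R)
    (h : ∀ i j, |A i j| ≤ c i) :
    |A.det| ≤ (Nat.factorial (Fintype.card n) : R) * ∏ i, c i :=
  calc |A.det| = |∑ σ : Equiv.Perm n, Equiv.Perm.sign σ • ∏ i, A i (σ i)| := by
        rw [← Matrix.det_transpose, Matrix.det_apply]; rfl
    _ ≤ ∑ σ : Equiv.Perm n, |Equiv.Perm.sign σ • ∏ i, A i (σ i)| := Finset.abs_sum_le_sum_abs _ _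
    _ = ∑ σ : Equiv.Perm n, ∏ i, |A i (σ i)| := Finset.sum_congr rfl fun σ _ => by
        rw [← Finset.abs_prod]
        rcases Int.units_eq_one_or (Equiv.Perm.sign σ) with hσ | hσ <;> simp [hσ]
    _ ≤ ∑ _σ : Equiv.Perm n, ∏ i, c i := Finset.sum_le_sum fun σ _ =>
        Finset.prod_le_prod (fun _ _ => abs_nonneg _) fun i _ => h i (σ i)
    _ = (Nat.factorial (Fintype.card n) : R) * ∏ i, c i := by
        rw [Finset.sum_const, Finset.card_univ, Fintype.card_perm, nsmul_eq_mul]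

theorem abs_sylvester_le (f g : Polynomial ℤ) (i j : Fin (f.natDegree + g.natDegree)) :
    |_root_.sylvester f g i j| ≤
      if (i : ℕ) < g.natDegree then (normInf f : ℤ) else (normInf g : ℤ) := by
  rw [_root_.sylvester, Matrix.of_apply]
  split_ifs <;> simp [abs_coeff_le_normInf]

theorem prod_fin_add_ite_lt {M : Type*} [CommMonoid M] (m n : ℕ) (a b : M) :
    ∏ i : Fin (m + n), (if (i : ℕ) < n then a else b) = a ^ n * b ^ m := by
  rw [Fin.prod_univ_eq_prod_range (fun i => if i < n then a else b), add_comm m n,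
    Finset.prod_range_add, Finset.prod_congr rfl fun i hi => if_pos (Finset.mem_range.mp hi)]
  simp

/-- Kalkbrener's bound (weakened form): for nonzero integer polynomials `f` and `s`,
`|Res(f, s)| ≤ (deg f + deg s)! · ‖f‖_∞^(deg s) · ‖s‖_∞^(deg f)`. -/
theorem stmt10 (f s : Polynomial ℤ) (hf : f ≠ 0) (hs : s ≠ 0) :
    |_root_.resultant f s| ≤
      (Nat.factorial (f.natDegree + s.natDegree) : ℤ)
        * (normInf f : ℤ) ^ s.natDegree * (normInf s : ℤ) ^ f.natDegree := by
  have h := abs_det_le_factorial_mul_prod _ _ (abs_sylvester_le f s)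
  rwa [Fintype.card_fin, prod_fin_add_ite_lt, ← mul_assoc] at h
end

section
/- Let p be a prime and n ≥ 2 an integer. Let f ∈ ℤ[X] be a nonzero polynomial of degree n with ‖f‖_∞ ≤ A · p^{1/2} for a real A ≥ 1, and let r̂ ∈ ℤ[X] be a nonzero polynomial with deg r̂ ≤ n − 1 and ‖r̂‖_∞ ≤ C · p^{(n−1)/n} for a real C ≥ 1. Then |Res(f, r̂)| ≤ (2n − 1)! · A^{n−1} · C^{n} · p^{3(n−1)/2}. In particular, writing Q = p^n, the resultant is at most (2n−1)!·A^{n−1}·C^{n} · Q^{3/2 − 3/(2n)}. -/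
open Polynomial

/-- Leibniz bound for a determinant whose `i`-th row is bounded entrywise by `b i`. -/
theorem abs_det_le_of_row_bound {ι : Type*} [Fintype ι] [DecidableEq ι] (M : Matrix ι ι ℤ)
    (b : ι → ℝ) (hM : ∀ i j, |(M i j : ℝ)| ≤ b i) :
    |(M.det : ℝ)| ≤ (Nat.factorial (Fintype.card ι) : ℝ) * ∏ i, b i := by
  rw [← Matrix.det_transpose, Matrix.det_apply']
  push_cast
  refine (Finset.abs_sum_le_sum_abs _ _).trans ?_
  have hterm : ∀ σ ∈ (Finset.univ : Finset (Equiv.Perm ι)),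
      |((Equiv.Perm.sign σ : ℤ) : ℝ) * ∏ i, ((M.transpose (σ i) i : ℤ) : ℝ)| ≤ ∏ i, b i := by
    intro σ _
    have hsign : |((Equiv.Perm.sign σ : ℤ) : ℝ)| = 1 := by
      rcases Int.units_eq_one_or (Equiv.Perm.sign σ) with h | h <;> simp [h]
    rw [abs_mul, hsign, one_mul, Finset.abs_prod]
    exact Finset.prod_le_prod (fun _ _ => abs_nonneg _) fun i _ => hM i (σ i)
  refine (Finset.sum_le_sum hterm).trans ?_
  simp [Fintype.card_perm]

/-- A resultant is bounded in terms of coefficient bounds of the two polynomials. -/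
theorem abs_resultant_le (f g : Polynomial ℤ) {F G : ℝ}
    (hf : ∀ i, |(f.coeff i : ℝ)| ≤ F) (hg : ∀ i, |(g.coeff i : ℝ)| ≤ G) :
    |(_root_.resultant f g : ℝ)| ≤
      (Nat.factorial (f.natDegree + g.natDegree) : ℝ) * (F ^ g.natDegree * G ^ f.natDegree) := by
  have hF : 0 ≤ F := (abs_nonneg _).trans (hf 0)
  have hG : 0 ≤ G := (abs_nonneg _).trans (hg 0)
  have h : |(_root_.resultant f g : ℝ)| ≤ _ := abs_det_le_of_row_bound (_root_.sylvester f g)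
    (fun i => if (i : ℕ) < g.natDegree then F else G) (by
      intro i j
      simp only [_root_.sylvester, Matrix.of_apply]
      split_ifs <;> first | exact hf _ | exact hg _ | simpa)
  rw [Fintype.card_fin, Fin.prod_univ_eq_prod_range (fun i => if i < g.natDegree then F else G),
    add_comm f.natDegree, Finset.prod_range_add,
    Finset.prod_congr rfl (fun i hi => if_pos (Finset.mem_range.mp hi))] at h
  simpa [add_comm] using h

/-- Norm bound for the reduced preimage with the JLSV₁ polynomial selection:
if `deg f = n`, `‖f‖_∞ ≤ A·p^(1/2)`, `deg r̂ ≤ n − 1` and `‖r̂‖_∞ ≤ C·p^((n−1)/n)`,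
then `|Res(f, r̂)| ≤ (2n−1)!·A^(n−1)·C^n·p^(3(n−1)/2)`, i.e. the norm of the preimage
is `O(Q^(3/2 − 3/(2n)))` where `Q = p^n`. -/
theorem stmt12 (p : ℕ) (hp : p.Prime) (n : ℕ) (hn : 2 ≤ n)
    (f : Polynomial ℤ) (hf0 : f ≠ 0) (hfdeg : f.natDegree = n)
    (A : ℝ) (hA : 1 ≤ A)
    (hfc : ∀ i, (|f.coeff i| : ℝ) ≤ A * (p : ℝ) ^ ((1 : ℝ) / 2))
    (r : Polynomial ℤ) (hr0 : r ≠ 0) (hrdeg : r.natDegree ≤ n - 1)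
    (C : ℝ) (hC : 1 ≤ C)
    (hrc : ∀ i, (|r.coeff i| : ℝ) ≤ C * (p : ℝ) ^ (((n : ℝ) - 1) / (n : ℝ))) :
    (|_root_.resultant f r| : ℝ) ≤
        (Nat.factorial (2 * n - 1) : ℝ) * A ^ (n - 1) * C ^ n
          * (p : ℝ) ^ (3 * ((n : ℝ) - 1) / 2) ∧
      (|_root_.resultant f r| : ℝ) ≤
        (Nat.factorial (2 * n - 1) : ℝ) * A ^ (n - 1) * C ^ n
          * ((p : ℝ) ^ n) ^ ((3 : ℝ) / 2 - 3 / (2 * (n : ℝ))) := by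
  have hp1 : (1 : ℝ) ≤ p := by exact_mod_cast hp.one_lt.le
  have hp0 : (0 : ℝ) ≤ p := zero_le_one.trans hp1
  have hn0 : (n : ℝ) ≠ 0 := by
    have : n ≠ 0 := by omega
    exact_mod_cast this
  have hF : 1 ≤ A * (p : ℝ) ^ ((1 : ℝ) / 2) :=
    one_le_mul_of_one_le_of_one_le hA (Real.one_le_rpow hp1 (by norm_num))
  have hbound : |(_root_.resultant f r : ℝ)| ≤
      (Nat.factorial (2 * n - 1) : ℝ) * A ^ (n - 1) * C ^ n
        * (p : ℝ) ^ (3 * ((n : ℝ) - 1) / 2) := by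
    refine (abs_resultant_le f r hfc hrc).trans ?_
    rw [hfdeg]
    have hpow : ((p : ℝ) ^ ((1 : ℝ) / 2)) ^ (n - 1) * ((p : ℝ) ^ (((n : ℝ) - 1) / n)) ^ n =
        (p : ℝ) ^ (3 * ((n : ℝ) - 1) / 2) := by
      rw [← Real.rpow_mul_natCast hp0, ← Real.rpow_mul_natCast hp0,
        ← Real.rpow_add (by linarith), Nat.cast_sub (by omega)]
      congr 1
      field_simp
      push_cast
      ring
    calc _ ≤ (Nat.factorial (2 * n - 1) : ℝ) * ((A * (p : ℝ) ^ ((1 : ℝ) / 2)) ^ (n - 1) *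
          (C * (p : ℝ) ^ (((n : ℝ) - 1) / n)) ^ n) := by
          gcongr
          · omega
      _ = _ := by
          rw [← hpow, mul_pow, mul_pow]
          ring
  refine ⟨hbound, hbound.trans_eq ?_⟩
  rw [← Real.rpow_natCast_mul hp0]
  congr 2
  field_simp
end
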